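/- arXiv:1406.7779 — 10 statements merged into one kernel-verified Lean document; each statement's English description precedes it below -/
import Mathlib

section
/- Let A₁, A₂, A₃, A₄ be four affinely independent (hence non-collinear and non-coplanar) points in ℝ³ and let B₁, B₂, B₃, B₄ be positive real numbers. Then the function f(X) = Σᵢ₌₁⁴ Bᵢ‖X − Aᵢ‖ on ℝ³ attains a global minimum, and its global minimizer is unique. -/
/-- The point of `EuclideanSpace ℝ (Fin 3)` with coordinates `x`, `y`, `z`. -/
noncomputable def pt (x y z : ℝ) : EuclideanSpace ℝ (Fin 3) :=
  (WithLp.equiv 2 (Fin 3 → ℝ)).symm ![x, y, z]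

section FermatTorricelli

variable {ι E : Type*} [Fintype ι] [NormedAddCommGroup E]

/-- A weighted sum of distances to finitely many points, with positive weights, attains its
minimum in a proper space. -/
theorem exists_forall_sum_mul_norm_sub_le [ProperSpace E] [Nonempty ι] (A : ι → E) (B : ι → ℝ)
    (hB : ∀ i, 0 < B i) :
    ∃ X : E, ∀ Y : E, ∑ i, B i * ‖X - A i‖ ≤ ∑ i, B i * ‖Y - A i‖ := by
  obtain ⟨j⟩ := ‹Nonempty ι›
  have hf : Continuous fun X : E ↦ ∑ i, B i * ‖X - A i‖ := by fun_prop
  refine hf.exists_forall_le_of_isBounded (A j) ?_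
  set c := ∑ i, B i * ‖A j - A i‖
  refine (Metric.isBounded_closedBall (x := A j) (r := c / B j)).subset ?_
  intro X hX
  rw [mem_closedBall_iff_norm, le_div_iff₀' (hB j)]
  exact (Finset.single_le_sum (f := fun i ↦ B i * ‖X - A i‖)
    (fun i _ ↦ mul_nonneg (hB i).le (norm_nonneg _)) (Finset.mem_univ j)).trans hX

variable [NormedSpace ℝ E]

/-- If `X - P` and `Y - P` are on the same ray and `X ≠ Y`, then `P` lies on the line `XY`. -/
theorem exists_eq_smul_sub_add_of_sameRay {X Y P : E} (hXY : X ≠ Y)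
    (h : SameRay ℝ (X - P) (Y - P)) : ∃ r : ℝ, P = r • (Y - X) + X := by
  obtain ⟨a, b, -, -, -, ha, hb⟩ := h.exists_eq_smul_add
  set s := X - P + (Y - P)
  have hYX : Y - X = (b - a) • s := by
    rw [sub_smul, ← ha, ← hb, sub_sub_sub_cancel_right]
  have hba : b - a ≠ 0 := by
    intro h0
    rw [h0, zero_smul, sub_eq_zero] at hYX
    exact hXY hYX.symm
  refine ⟨-a / (b - a), ?_⟩
  rw [hYX, smul_smul, div_mul_cancel₀ _ hba, neg_smul, ← ha]
  abel

/-- In a strictly convex space, a weighted sum of distances to finitely many non-collinear points,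
with positive weights, has at most one minimizer. -/
theorem eq_of_forall_sum_mul_norm_sub_le [StrictConvexSpace ℝ E] {A : ι → E} {B : ι → ℝ}
    (hA : ¬ Collinear ℝ (Set.range A)) (hB : ∀ i, 0 < B i) {X Y : E}
    (hX : ∀ Z : E, ∑ i, B i * ‖X - A i‖ ≤ ∑ i, B i * ‖Z - A i‖)
    (hY : ∀ Z : E, ∑ i, B i * ‖Y - A i‖ ≤ ∑ i, B i * ‖Z - A i‖) : X = Y := by
  by_contra hXY
  obtain ⟨j, hj⟩ : ∃ j, ¬ SameRay ℝ (X - A j) (Y - A j) := by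
    by_contra! h
    refine hA ((collinear_iff_exists_forall_eq_smul_vadd (k := ℝ) _).2 ⟨X, Y - X, ?_⟩)
    rintro _ ⟨i, rfl⟩
    exact exists_eq_smul_sub_add_of_sameRay hXY (h i)
  set M : E := (1 / 2 : ℝ) • (X + Y)
  have hM (i : ι) : ‖M - A i‖ = ‖(X - A i) + (Y - A i)‖ / 2 := by
    have : M - A i = (1 / 2 : ℝ) • ((X - A i) + (Y - A i)) := by
      simp only [M]
      module
    rw [this, norm_smul, Real.norm_of_nonneg (by norm_num)]
    ring
  have hlt : ∑ i, B i * ‖M - A i‖ < ∑ i, (B i * ‖X - A i‖ + B i * ‖Y - A i‖) / 2 := by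
    refine Finset.sum_lt_sum (fun i _ ↦ ?_) ⟨j, Finset.mem_univ j, ?_⟩
    · rw [hM]
      linarith [mul_le_mul_of_nonneg_left (norm_add_le (X - A i) (Y - A i)) (hB i).le]
    · rw [hM]
      linarith [mul_lt_mul_of_pos_left (norm_add_lt_of_not_sameRay hj) (hB j)]
  rw [← Finset.sum_div, Finset.sum_add_distrib] at hlt
  linarith [hX M, hY M]

end FermatTorricelli

/-- **Existence and uniqueness of the weighted Fermat–Torricelli point.**
Given four affinely independent points `A 0, A 1, A 2, A 3` in `ℝ³` and positive weights
`B 0, B 1, B 2, B 3`, the function `f X = ∑ i, B i * ‖X - A i‖` attains a global minimum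
at a unique point. -/
theorem weighted_fermat_torricelli_exists_unique
    (A : Fin 4 → EuclideanSpace ℝ (Fin 3)) (hA : AffineIndependent ℝ A)
    (B : Fin 4 → ℝ) (hB : ∀ i, 0 < B i) :
    ∃! X : EuclideanSpace ℝ (Fin 3),
      ∀ Y : EuclideanSpace ℝ (Fin 3), ∑ i, B i * ‖X - A i‖ ≤ ∑ i, B i * ‖Y - A i‖ := by
  have hcol : ¬ Collinear ℝ (Set.range A) := fun h ↦ by
    have h1 := h.finrank_le_one
    rw [hA.finrank_vectorSpan (n := 3) (by simp)] at h1
    omega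
  obtain ⟨X, hX⟩ := exists_forall_sum_mul_norm_sub_le A B hB
  exact ⟨X, hX, fun Y hY ↦ eq_of_forall_sum_mul_norm_sub_le hcol hB hY hX⟩
end

section
/- Let A₁, A₂, A₃, A₄ be four affinely independent points in ℝ³ with positive weights B₁, B₂, B₃, B₄, and let A₀ be a global minimizer of f(X) = Σᵢ₌₁⁴ Bᵢ‖X − Aᵢ‖. If for every i ∈ {1,2,3,4} one has ‖Σ_{j≠i} Bⱼ (Aⱼ − Aᵢ)/‖Aⱼ − Aᵢ‖‖ > Bᵢ, then A₀ is distinct from each of A₁, A₂, A₃, A₄ and satisfies the weighted floating equilibrium condition Σᵢ₌₁⁴ Bᵢ (Aᵢ − A₀)/‖Aᵢ − A₀‖ = 0. -/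
/-- The distance to a point `a`, along a line through `x ≠ a`, has derivative
`-⟪a - x, v⟫ / ‖a - x‖`, where `v` is the direction of the line. -/
theorem hasDerivAt_norm_add_smul_sub {E : Type*} [NormedAddCommGroup E] [InnerProductSpace ℝ E]
    {x a : E} (hxa : a ≠ x) (v : E) :
    HasDerivAt (fun t : ℝ => ‖x + t • v - a‖) (-(inner ℝ (a - x) v / ‖a - x‖)) 0 := by
  have hline : HasDerivAt (fun t : ℝ => x + t • v - a) v 0 := by
    simpa using (((hasDerivAt_id (0 : ℝ)).smul_const v).const_add x).sub_const a
  have hpos : ‖x - a‖ ≠ 0 := norm_ne_zero_iff.mpr (sub_ne_zero.mpr hxa.symm)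
  have hsqrt := hline.norm_sq.sqrt (by simpa using hpos)
  simp only [Real.sqrt_sq (norm_nonneg _), zero_smul, add_zero] at hsqrt
  convert hsqrt using 1
  rw [← neg_sub x a, inner_neg_left, norm_neg]
  field_simp

/-- If `x` minimizes a weighted sum of distances in which `x` itself carries the weight `c` and all
the other points differ from `x`, then the resultant of the weighted unit vectors from `x` to
the other points has norm at most `c`. -/
theorem norm_sum_smul_unit_le_of_minimizer {ι E : Type*} [NormedAddCommGroup E]
    [InnerProductSpace ℝ E] (s : Finset ι) (A : ι → E) (B : ι → ℝ) {x : E} {c : ℝ} (hc : 0 ≤ c)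
    (hA : ∀ j ∈ s, A j ≠ x)
    (hmin : ∀ Y, ∑ j ∈ s, B j * ‖x - A j‖ ≤ c * ‖Y - x‖ + ∑ j ∈ s, B j * ‖Y - A j‖) :
    ‖∑ j ∈ s, (B j / ‖A j - x‖) • (A j - x)‖ ≤ c := by
  set R := ∑ j ∈ s, (B j / ‖A j - x‖) • (A j - x) with hR
  have hderiv : HasDerivAt (fun t : ℝ => ∑ j ∈ s, B j * ‖x + t • R - A j‖) (-‖R‖ ^ 2) 0 := by
    have hval : -‖R‖ ^ 2 = ∑ j ∈ s, B j * -(inner ℝ (A j - x) R / ‖A j - x‖) := by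
      rw [← real_inner_self_eq_norm_sq]
      nth_rewrite 1 [hR]
      rw [sum_inner, ← Finset.sum_neg_distrib]
      refine Finset.sum_congr rfl fun j _ => ?_
      rw [real_inner_smul_left]
      ring
    rw [hval]
    exact HasDerivAt.fun_sum fun j hj =>
      (hasDerivAt_norm_add_smul_sub (hA j hj) R).const_mul (B j)
  have hslope : -(c * ‖R‖) ≤ -‖R‖ ^ 2 := by
    refine ge_of_tendsto hderiv.tendsto_slope_zero_right ?_
    filter_upwards [self_mem_nhdsWithin] with t ht
    have ht : 0 < t := ht
    have h := hmin (x + t • R)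
    rw [add_sub_cancel_left, norm_smul, Real.norm_of_nonneg ht.le] at h
    rw [smul_eq_mul, inv_mul_eq_div, le_div_iff₀ ht]
    simp only [zero_add, zero_smul, add_zero]
    linarith
  by_contra! hlt
  nlinarith

/-- **Weighted floating case of the Fermat–Torricelli problem for a tetrahedron.**
If the floating condition `‖∑_{j ≠ i} B j • u(A i, A j)‖ > B i` holds at every vertex, then
the weighted Fermat–Torricelli point `A₀` (a global minimizer of `X ↦ ∑ i, B i * ‖X - A i‖`)
is distinct from every vertex and satisfies the weighted floating equilibrium condition
`∑ i, B i • (A i - A₀) / ‖A i - A₀‖ = 0`. -/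
theorem weighted_fermat_torricelli_floating_case
    (A : Fin 4 → EuclideanSpace ℝ (Fin 3)) (hA : AffineIndependent ℝ A)
    (B : Fin 4 → ℝ) (hB : ∀ i, 0 < B i)
    (A₀ : EuclideanSpace ℝ (Fin 3))
    (hmin : ∀ Y : EuclideanSpace ℝ (Fin 3), ∑ i, B i * ‖A₀ - A i‖ ≤ ∑ i, B i * ‖Y - A i‖)
    (hfloat : ∀ i : Fin 4,
      B i < ‖∑ j ∈ Finset.univ.erase i, (B j / ‖A j - A i‖) • (A j - A i)‖) :
    (∀ i : Fin 4, A₀ ≠ A i) ∧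
      ∑ i, (B i / ‖A i - A₀‖) • (A i - A₀) = (0 : EuclideanSpace ℝ (Fin 3)) := by
  have hne : ∀ i, A₀ ≠ A i := by
    rintro i rfl
    refine (hfloat i).not_ge (norm_sum_smul_unit_le_of_minimizer _ A B (hB i).le
      (fun j hj => hA.injective.ne (Finset.ne_of_mem_erase hj)) fun Y => ?_)
    have h := hmin Y
    rw [← Finset.add_sum_erase _ _ (Finset.mem_univ i),
      ← Finset.add_sum_erase _ _ (Finset.mem_univ i)] at h
    simpa using h
  refine ⟨hne, norm_le_zero_iff.mp ?_⟩
  exact norm_sum_smul_unit_le_of_minimizer _ A B le_rfl (fun j _ => (hne j).symm)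
    fun Y => by simpa using hmin Y
end

section
/- Let A₁, A₂, A₃, A₄ be four affinely independent points in ℝ³ with positive weights B₁, B₂, B₃, B₄. If there is an index i ∈ {1,2,3,4} such that ‖Σ_{j≠i} Bⱼ (Aⱼ − Aᵢ)/‖Aⱼ − Aᵢ‖‖ ≤ Bᵢ, then the point Aᵢ is a global minimizer of f(X) = Σᵢ₌₁⁴ Bᵢ‖X − Aᵢ‖ (the weighted absorbed case: the weighted Fermat-Torricelli point coincides with Aᵢ). -/
/-- The tangent-plane inequality for the norm at `v`, in the direction `w`. -/
theorem norm_sub_inner_div_norm_le {E : Type*} [NormedAddCommGroup E] [InnerProductSpace ℝ E]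
    (v w : E) : ‖v‖ - inner ℝ v w / ‖v‖ ≤ ‖w - v‖ := by
  rcases eq_or_ne v 0 with rfl | hv
  · simp
  · have hpos : 0 < ‖v‖ := norm_pos_iff.mpr hv
    have h := real_inner_le_norm v (v - w)
    rw [inner_sub_right, real_inner_self_eq_norm_sq, norm_sub_rev v w] at h
    rw [sub_le_iff_le_add, ← sub_le_iff_le_add', le_div_iff₀ hpos]
    linarith

/-- If the weighted sum of the unit vectors from `A i` to the other points has norm at most `B i`,
then `A i` minimizes the weighted sum of distances to the points `A k`. -/
theorem sum_weighted_norm_sub_le_of_norm_sum_le {ι E : Type*} [Fintype ι] [DecidableEq ι]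
    [NormedAddCommGroup E] [InnerProductSpace ℝ E] (A : ι → E) (B : ι → ℝ) (hB : ∀ k, 0 ≤ B k)
    (i : ι)
    (habs : ‖∑ j ∈ Finset.univ.erase i, (B j / ‖A j - A i‖) • (A j - A i)‖ ≤ B i) (Y : E) :
    ∑ k, B k * ‖A i - A k‖ ≤ ∑ k, B k * ‖Y - A k‖ := by
  rw [← Finset.add_sum_erase _ _ (Finset.mem_univ i),
    ← Finset.add_sum_erase _ (fun k => B k * ‖Y - A k‖) (Finset.mem_univ i),
    sub_self, norm_zero, mul_zero, zero_add]
  have hterm : ∀ j ∈ Finset.univ.erase i, B j * ‖A i - A j‖ ≤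
      inner ℝ ((B j / ‖A j - A i‖) • (A j - A i)) (Y - A i) + B j * ‖Y - A j‖ := by
    intro j _
    have h := mul_le_mul_of_nonneg_left
      (norm_sub_inner_div_norm_le (A j - A i) (Y - A i)) (hB j)
    rw [sub_sub_sub_cancel_right, mul_sub, ← mul_div_assoc] at h
    rw [real_inner_smul_left, norm_sub_rev (A i), div_mul_eq_mul_div]
    linarith
  have hinner := (real_inner_le_norm _ (Y - A i)).trans
    (mul_le_mul_of_nonneg_right habs (norm_nonneg (Y - A i)))
  rw [sum_inner] at hinner
  calc _ ≤ _ := Finset.sum_le_sum hterm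
    _ = _ := Finset.sum_add_distrib
    _ ≤ _ := by gcongr


/-- **Weighted absorbed case of the Fermat–Torricelli problem for a tetrahedron.**
If at some vertex `A i` one has `‖∑_{j ≠ i} B j • u(A i, A j)‖ ≤ B i`, then `A i` itself is a
global minimizer of `X ↦ ∑ i, B i * ‖X - A i‖`, i.e. the weighted Fermat–Torricelli point
coincides with `A i`. -/
theorem weighted_fermat_torricelli_absorbed_case
    (A : Fin 4 → EuclideanSpace ℝ (Fin 3)) (hA : AffineIndependent ℝ A)
    (B : Fin 4 → ℝ) (hB : ∀ i, 0 < B i)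
    (i : Fin 4)
    (habs : ‖∑ j ∈ Finset.univ.erase i, (B j / ‖A j - A i‖) • (A j - A i)‖ ≤ B i) :
    ∀ Y : EuclideanSpace ℝ (Fin 3), ∑ k, B k * ‖A i - A k‖ ≤ ∑ k, B k * ‖Y - A k‖ :=
  sum_weighted_norm_sub_le_of_norm_sum_le A B (fun k => (hB k).le) i habs
end

section
/- Let a > 0, B₁ = B₂ > 0 and B₃ = B₄ > 0. For the regular tetrahedron with vertices A₁ = (a/2, 0, a√2/4), A₂ = (−a/2, 0, a√2/4), A₃ = (0, a/2, −a√2/4), A₄ = (0, −a/2, −a√2/4), the global minimizer A₀ of f(X) = B₁‖X − A₁‖ + B₂‖X − A₂‖ + B₃‖X − A₃‖ + B₄‖X − A₄‖ lies on the z-axis, i.e. A₀ = (0, 0, y) for some real y; moreover for every y ∈ ℝ one has f((0,0,y)) = 2·(B₁√(a²/4 + (a√2/4 − y)²) + B₄√(a²/4 + (a√2/4 + y)²)). -/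
lemma two_mul_sqrt_le_sqrt_add_sqrt (p h k : ℝ) (hk : 0 ≤ k) :
    2 * Real.sqrt (h ^ 2 + k) ≤ Real.sqrt ((p - h) ^ 2 + k) + Real.sqrt ((p + h) ^ 2 + k) := by
  have hS : Real.sqrt (h ^ 2 + k) ^ 2 = h ^ 2 + k := Real.sq_sqrt (by positivity)
  have hU : Real.sqrt ((p - h) ^ 2 + k) ^ 2 = (p - h) ^ 2 + k := Real.sq_sqrt (by positivity)
  have hV : Real.sqrt ((p + h) ^ 2 + k) ^ 2 = (p + h) ^ 2 + k := Real.sq_sqrt (by positivity)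
  have hprod : h ^ 2 + k - p ^ 2 ≤ Real.sqrt ((p - h) ^ 2 + k) * Real.sqrt ((p + h) ^ 2 + k) := by
    refine le_of_abs_le (abs_le_of_sq_le_sq ?_ (by positivity))
    rw [mul_pow, hU, hV]
    nlinarith [mul_nonneg hk (sq_nonneg p)]
  refine le_of_abs_le (abs_le_of_sq_le_sq ?_ (by positivity))
  nlinarith

lemma norm_pt_sub_pt (x y z x' y' z' : ℝ) :
    ‖pt x y z - pt x' y' z'‖ = Real.sqrt ((x - x') ^ 2 + (y - y') ^ 2 + (z - z') ^ 2) := by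
  simp [EuclideanSpace.norm_eq, Fin.sum_univ_three, pt]

lemma eq_pt (X : EuclideanSpace ℝ (Fin 3)) : X = pt (X 0) (X 1) (X 2) := by
  ext i
  fin_cases i <;> simp [pt]

/-- **Symmetry reduction for the regular tetrahedron with two pairs of equal weights.**
For the regular tetrahedron `A₁ = (a/2, 0, a√2/4)`, `A₂ = (-a/2, 0, a√2/4)`,
`A₃ = (0, a/2, -a√2/4)`, `A₄ = (0, -a/2, -a√2/4)` with weights `B₁ = B₂ > 0`,
`B₃ = B₄ > 0`, every global minimizer of `f X = ∑ Bᵢ ‖X - Aᵢ‖` lies on the `z`-axis,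
and on the `z`-axis the objective is
`f (0,0,y) = 2 (B₁ √(a²/4 + (a√2/4 - y)²) + B₄ √(a²/4 + (a√2/4 + y)²))`. -/
theorem regular_tetrahedron_objective_on_axis
    (a B₁ B₂ B₃ B₄ : ℝ) (ha : 0 < a) (h12 : B₁ = B₂) (h34 : B₃ = B₄)
    (hB₁ : 0 < B₁) (hB₃ : 0 < B₃)
    (A₁ A₂ A₃ A₄ : EuclideanSpace ℝ (Fin 3))
    (hA₁ : A₁ = pt (a / 2) 0 (a * Real.sqrt 2 / 4))
    (hA₂ : A₂ = pt (-(a / 2)) 0 (a * Real.sqrt 2 / 4))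
    (hA₃ : A₃ = pt 0 (a / 2) (-(a * Real.sqrt 2 / 4)))
    (hA₄ : A₄ = pt 0 (-(a / 2)) (-(a * Real.sqrt 2 / 4)))
    (f : EuclideanSpace ℝ (Fin 3) → ℝ)
    (hf : ∀ X, f X = B₁ * ‖X - A₁‖ + B₂ * ‖X - A₂‖ + B₃ * ‖X - A₃‖ + B₄ * ‖X - A₄‖) :
    (∀ A₀ : EuclideanSpace ℝ (Fin 3), (∀ Y, f A₀ ≤ f Y) → ∃ y : ℝ, A₀ = pt 0 0 y) ∧
      (∀ y : ℝ, f (pt 0 0 y) =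
        2 * (B₁ * Real.sqrt (a ^ 2 / 4 + (a * Real.sqrt 2 / 4 - y) ^ 2) +
          B₄ * Real.sqrt (a ^ 2 / 4 + (a * Real.sqrt 2 / 4 + y) ^ 2))) := by
  subst h12 h34 hA₁ hA₂ hA₃ hA₄
  have haxis : ∀ y : ℝ, f (pt 0 0 y) =
      2 * (B₁ * Real.sqrt (a ^ 2 / 4 + (a * Real.sqrt 2 / 4 - y) ^ 2) +
        B₃ * Real.sqrt (a ^ 2 / 4 + (a * Real.sqrt 2 / 4 + y) ^ 2)) := by
    intro y
    simp only [hf, norm_pt_sub_pt]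
    ring_nf
  refine ⟨fun A₀ hmin => ⟨A₀ 2, ?_⟩, haxis⟩
  obtain ⟨p, q, z, rfl⟩ : ∃ p q z, A₀ = pt p q z := ⟨_, _, _, eq_pt A₀⟩
  have hz : (pt p q z) 2 = z := by simp [pt]
  rw [hz]
  have hle := hmin (pt 0 0 z)
  rw [haxis, hf] at hle
  simp only [norm_pt_sub_pt] at hle
  set c := a * Real.sqrt 2 / 4
  clear_value c
  have h₁ := two_mul_sqrt_le_sqrt_add_sqrt p (a / 2) (q ^ 2 + (z - c) ^ 2) (by positivity)
  have h₂ := two_mul_sqrt_le_sqrt_add_sqrt q (a / 2) (p ^ 2 + (z + c) ^ 2) (by positivity)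
  have e₁ : (p - a / 2) ^ 2 + (q - 0) ^ 2 + (z - c) ^ 2
      = (p - a / 2) ^ 2 + (q ^ 2 + (z - c) ^ 2) := by ring
  have e₂ : (p - -(a / 2)) ^ 2 + (q - 0) ^ 2 + (z - c) ^ 2
      = (p + a / 2) ^ 2 + (q ^ 2 + (z - c) ^ 2) := by ring
  have e₃ : (p - 0) ^ 2 + (q - a / 2) ^ 2 + (z - -c) ^ 2
      = (q - a / 2) ^ 2 + (p ^ 2 + (z + c) ^ 2) := by ring
  have e₄ : (p - 0) ^ 2 + (q - -(a / 2)) ^ 2 + (z - -c) ^ 2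
      = (q + a / 2) ^ 2 + (p ^ 2 + (z + c) ^ 2) := by ring
  rw [e₁, e₂, e₃, e₄] at hle
  have m₁ : Real.sqrt (a ^ 2 / 4 + (c - z) ^ 2)
      ≤ Real.sqrt ((a / 2) ^ 2 + (q ^ 2 + (z - c) ^ 2)) :=
    Real.sqrt_le_sqrt (by linarith [sq_nonneg q])
  have m₂ : Real.sqrt (a ^ 2 / 4 + (c + z) ^ 2)
      ≤ Real.sqrt ((a / 2) ^ 2 + (p ^ 2 + (z + c) ^ 2)) :=
    Real.sqrt_le_sqrt (by linarith [sq_nonneg p])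
  have w₁ := mul_le_mul_of_nonneg_left h₁ hB₁.le
  have w₂ := mul_le_mul_of_nonneg_left h₂ hB₃.le
  have v₁ := mul_le_mul_of_nonneg_left m₁ hB₁.le
  have v₂ := mul_le_mul_of_nonneg_left m₂ hB₃.le
  have hq : q = 0 := by
    by_contra hq
    have hq2 : 0 < q ^ 2 := by positivity
    have hlt : Real.sqrt (a ^ 2 / 4 + (c - z) ^ 2)
        < Real.sqrt ((a / 2) ^ 2 + (q ^ 2 + (z - c) ^ 2)) :=
      Real.sqrt_lt_sqrt (by positivity) (by linarith)
    linarith [mul_lt_mul_of_pos_left hlt hB₁]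
  have hp : p = 0 := by
    by_contra hp
    have hp2 : 0 < p ^ 2 := by positivity
    have hlt : Real.sqrt (a ^ 2 / 4 + (c + z) ^ 2)
        < Real.sqrt ((a / 2) ^ 2 + (p ^ 2 + (z + c) ^ 2)) :=
      Real.sqrt_lt_sqrt (by positivity) (by linarith)
    linarith [mul_lt_mul_of_pos_left hlt hB₃]
  rw [hp, hq]
end

section
/- Let a > 0 and B₁, B₄ > 0, and set h = a√2/4 and g(y) = B₁√(a²/4 + (h − y)²) + B₄√(a²/4 + (h + y)²) for y ∈ ℝ. If y₀ ∈ ℝ is a point where g attains its global minimum (equivalently, a critical point of g), then y₀ satisfies the quartic equation 64 y₀⁴ (B₁² − B₄²) − 8√2 a³ y₀ (B₁² + B₄²) + 3 a⁴ (B₁² − B₄²) = 0. -/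
/-- **The first-order condition for the reduced objective yields a quartic.**
Let `g y = B₁ √(a²/4 + (h - y)²) + B₄ √(a²/4 + (h + y)²)` with `h = a√2/4`.  If `g` attains
its global minimum at `y₀`, then `y₀` satisfies the quartic equation
`64 y₀⁴ (B₁² - B₄²) - 8√2 a³ y₀ (B₁² + B₄²) + 3 a⁴ (B₁² - B₄²) = 0`. -/
theorem min_of_reduced_objective_satisfies_quartic
    (a B₁ B₄ : ℝ) (ha : 0 < a) (hB₁ : 0 < B₁) (hB₄ : 0 < B₄)
    (h : ℝ) (hh : h = a * Real.sqrt 2 / 4)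
    (g : ℝ → ℝ)
    (hg : ∀ y, g y = B₁ * Real.sqrt (a ^ 2 / 4 + (h - y) ^ 2) +
      B₄ * Real.sqrt (a ^ 2 / 4 + (h + y) ^ 2))
    (y₀ : ℝ) (hmin : ∀ y, g y₀ ≤ g y) :
    64 * y₀ ^ 4 * (B₁ ^ 2 - B₄ ^ 2) - 8 * Real.sqrt 2 * a ^ 3 * y₀ * (B₁ ^ 2 + B₄ ^ 2) +
      3 * a ^ 4 * (B₁ ^ 2 - B₄ ^ 2) = 0 := by
  have hs : Real.sqrt 2 ^ 2 = 2 := Real.sq_sqrt (by norm_num)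
  have hP : 0 < a ^ 2 / 4 + (h - y₀) ^ 2 := by positivity
  have hQ : 0 < a ^ 2 / 4 + (h + y₀) ^ 2 := by positivity
  have hd₁ : HasDerivAt (fun y : ℝ => a ^ 2 / 4 + (h - y) ^ 2) (-(2 * (h - y₀))) y₀ := by
    exact ((((hasDerivAt_id' y₀).const_sub h).fun_pow 2).const_add (a ^ 2 / 4)).congr_deriv
      (by simp)
  have hd₂ : HasDerivAt (fun y : ℝ => a ^ 2 / 4 + (h + y) ^ 2) (2 * (h + y₀)) y₀ := by
    exact ((((hasDerivAt_id' y₀).const_add h).fun_pow 2).const_add (a ^ 2 / 4)).congr_deriv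
      (by simp)
  have hderiv := ((hd₁.sqrt hP.ne').const_mul B₁).add ((hd₂.sqrt hQ.ne').const_mul B₄)
  have hloc : IsLocalMin g y₀ := Filter.Eventually.of_forall hmin
  rw [show g = _ from funext hg] at hloc
  have hcrit := hloc.hasDerivAt_eq_zero hderiv
  have hPs := Real.sq_sqrt hP.le
  have hQs := Real.sq_sqrt hQ.le
  have hP₀ := Real.sqrt_pos.mpr hP
  have hQ₀ := Real.sqrt_pos.mpr hQ
  set P := Real.sqrt (a ^ 2 / 4 + (h - y₀) ^ 2)
  set Q := Real.sqrt (a ^ 2 / 4 + (h + y₀) ^ 2)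
  have hbal : B₁ * (h - y₀) * Q = B₄ * (h + y₀) * P := by
    field_simp at hcrit
    linarith
  have hsq : B₁ ^ 2 * (h - y₀) ^ 2 * (a ^ 2 / 4 + (h + y₀) ^ 2) =
      B₄ ^ 2 * (h + y₀) ^ 2 * (a ^ 2 / 4 + (h - y₀) ^ 2) := by
    rw [← hPs, ← hQs]
    linear_combination (B₁ * (h - y₀) * Q + B₄ * (h + y₀) * P) * hbal
  have hh₂ : a ^ 2 = 8 * h ^ 2 := by
    rw [hh]
    linear_combination (-(a ^ 2) / 2) * hs
  have hh₃ : 8 * Real.sqrt 2 * a ^ 3 = 256 * h ^ 3 := by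
    rw [hh]
    linear_combination (-4 * Real.sqrt 2 * a ^ 3) * hs
  have hh₄ : a ^ 4 = 64 * h ^ 4 := by
    linear_combination (a ^ 2 + 8 * h ^ 2) * hh₂
  rw [hh₂] at hsq
  rw [hh₃, hh₄]
  linear_combination 64 * hsq
end

section
/- Let a > 0 and B₁ > B₄ > 0, and set g(y) = B₁√(a²/4 + (a√2/4 − y)²) + B₄√(a²/4 + (a√2/4 + y)²) for y ∈ ℝ. Then the unique global minimizer y₀ of g satisfies 0 < y₀ < a√2/4; that is, the weighted Fermat-Torricelli point (0,0,y₀) lies in the interior of the regular tetrahedron, strictly between the midpoint O of the common perpendicular and the midpoint A₁₂ of the edge A₁A₂ carrying the larger weights. -/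
/-- The derivative of `y ↦ √(k + (f y)²)` for `k > 0`. -/
theorem hasDerivAt_sqrt_add_sq {k : ℝ} (hk : 0 < k) {f : ℝ → ℝ} {f' y : ℝ}
    (hf : HasDerivAt f f' y) :
    HasDerivAt (fun z => Real.sqrt (k + f z ^ 2)) (f y * f' / Real.sqrt (k + f y ^ 2)) y := by
  have hpos : 0 < k + f y ^ 2 := by positivity
  convert ((hf.fun_pow 2).const_add k).sqrt hpos.ne' using 1
  field_simp
  simp
  ring

/-- The function `t ↦ t / √(k + t²)` is monotone on nonnegative reals, in cross-multiplied form. -/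
theorem mul_sqrt_add_sq_le {k u v : ℝ} (hk : 0 < k) (hv : 0 ≤ v) (huv : v ≤ u) :
    v * Real.sqrt (k + u ^ 2) ≤ u * Real.sqrt (k + v ^ 2) := by
  have hu : 0 ≤ u := hv.trans huv
  refine (sq_le_sq₀ (by positivity) (by positivity)).1 ?_
  rw [mul_pow, mul_pow, Real.sq_sqrt (by positivity), Real.sq_sqrt (by positivity)]
  have := mul_le_mul_of_nonneg_left (pow_le_pow_left₀ hv huv 2) hk.le
  linarith

/-- **Location of the weighted Fermat–Torricelli point for `B₁ > B₄`.**
For `g y = B₁ √(a²/4 + (a√2/4 - y)²) + B₄ √(a²/4 + (a√2/4 + y)²)` with `B₁ > B₄ > 0`, any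
global minimizer `y₀` of `g` satisfies `0 < y₀ < a√2/4`; i.e. the weighted Fermat–Torricelli
point `(0,0,y₀)` lies strictly between the midpoint `O` of the common perpendicular and the
midpoint `A₁₂` of the edge carrying the larger weights. -/
theorem reduced_objective_min_location
    (a B₁ B₄ : ℝ) (ha : 0 < a) (hB₄ : 0 < B₄) (hB : B₄ < B₁)
    (g : ℝ → ℝ)
    (hg : ∀ y, g y = B₁ * Real.sqrt (a ^ 2 / 4 + (a * Real.sqrt 2 / 4 - y) ^ 2) +
      B₄ * Real.sqrt (a ^ 2 / 4 + (a * Real.sqrt 2 / 4 + y) ^ 2))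
    (y₀ : ℝ) (hmin : ∀ y, g y₀ ≤ g y) :
    0 < y₀ ∧ y₀ < a * Real.sqrt 2 / 4 := by
  have hk : 0 < a ^ 2 / 4 := by positivity
  have hc : 0 < a * Real.sqrt 2 / 4 := by positivity
  generalize a ^ 2 / 4 = k at *
  generalize a * Real.sqrt 2 / 4 = c at *
  have hderiv : HasDerivAt g (B₁ * ((c - y₀) * (-1) / Real.sqrt (k + (c - y₀) ^ 2)) +
      B₄ * ((c + y₀) * 1 / Real.sqrt (k + (c + y₀) ^ 2))) y₀ := by
    rw [funext hg]
    exact ((hasDerivAt_sqrt_add_sq hk ((hasDerivAt_id' y₀).const_sub c)).const_mul B₁).add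
      ((hasDerivAt_sqrt_add_sq hk ((hasDerivAt_id' y₀).const_add c)).const_mul B₄)
  have hcrit := IsLocalMin.hasDerivAt_eq_zero (Filter.Eventually.of_forall hmin) hderiv
  have hp : 0 < Real.sqrt (k + (c - y₀) ^ 2) := by positivity
  have hq : 0 < Real.sqrt (k + (c + y₀) ^ 2) := by positivity
  have hbalance : B₁ * ((c - y₀) * Real.sqrt (k + (c + y₀) ^ 2)) =
      B₄ * ((c + y₀) * Real.sqrt (k + (c - y₀) ^ 2)) := by
    field_simp at hcrit
    linarith
  have hB₁ : 0 < B₁ := hB₄.trans hB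
  constructor
  · by_contra! hy
    have hu : 0 < (c - y₀) * Real.sqrt (k + (c + y₀) ^ 2) := mul_pos (by linarith) hq
    have hv : 0 < c + y₀ :=
      pos_of_mul_pos_left (pos_of_mul_pos_right (hbalance ▸ mul_pos hB₁ hu) hB₄.le) hp.le
    have hle := mul_sqrt_add_sq_le hk hv.le (show c + y₀ ≤ c - y₀ by linarith)
    have := mul_le_mul_of_nonneg_left hle hB₄.le
    have := mul_lt_mul_of_pos_right hB hu
    linarith
  · by_contra! hy
    have hr : 0 < B₄ * ((c + y₀) * Real.sqrt (k + (c - y₀) ^ 2)) :=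
      mul_pos hB₄ (mul_pos (by linarith) hp)
    have hl : B₁ * ((c - y₀) * Real.sqrt (k + (c + y₀) ^ 2)) ≤ 0 :=
      mul_nonpos_of_nonneg_of_nonpos hB₁.le
        (mul_nonpos_of_nonpos_of_nonneg (by linarith) hq.le)
    linarith
end

section
/- Let a > 0 and B₁ > B₄ > 0. Then the quartic polynomial p(y) = 64 y⁴ (B₁² − B₄²) − 8√2 a³ y (B₁² + B₄²) + 3 a⁴ (B₁² − B₄²) has exactly two real roots; one real root lies in the open interval (0, a√2/4) and the other real root is greater than a√2/4. -/
/-- A polynomial `A y⁴ - K y + C` with `A ≠ 0` has at most two distinct real roots. -/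
lemma quartic_root_eq_or_eq {A K C x₁ x₂ y : ℝ} (hA : A ≠ 0) (hx : x₁ ≠ x₂)
    (h₁ : A * x₁ ^ 4 - K * x₁ + C = 0) (h₂ : A * x₂ ^ 4 - K * x₂ + C = 0)
    (hy : A * y ^ 4 - K * y + C = 0) : y = x₁ ∨ y = x₂ := by
  by_contra! h
  obtain ⟨hy₁, hy₂⟩ := h
  have e₁ : A * (y ^ 3 + y ^ 2 * x₁ + y * x₁ ^ 2 + x₁ ^ 3) - K = 0 :=
    mul_left_cancel₀ (sub_ne_zero.2 hy₁) (by linear_combination hy - h₁)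
  have e₂ : A * (y ^ 3 + y ^ 2 * x₂ + y * x₂ ^ 2 + x₂ ^ 3) - K = 0 :=
    mul_left_cancel₀ (sub_ne_zero.2 hy₂) (by linear_combination hy - h₂)
  have e₃ : y ^ 2 + x₁ ^ 2 + x₂ ^ 2 + y * x₁ + y * x₂ + x₁ * x₂ = 0 :=
    mul_left_cancel₀ (mul_ne_zero hA (sub_ne_zero.2 hx)) (by linear_combination e₁ - e₂)
  have hpos : 0 < (x₁ - x₂) ^ 2 := by
    have := sub_ne_zero.2 hx
    positivity
  nlinarith [sq_nonneg (y + x₁ + x₂), sq_nonneg (x₁ + x₂), sq_nonneg y]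

/-- A polynomial `A y⁴ - K y + C` with `A, C > 0` and `K ≥ 0` that is negative at some `c > 0`
has exactly two real roots, one on each side of `c`, and both are positive. -/
lemma quartic_exists_two_roots {A K C c : ℝ} (hA : 0 < A) (hK : 0 ≤ K) (hC : 0 < C) (hc : 0 < c)
    (hneg : A * c ^ 4 - K * c + C < 0) :
    ∃ y₁ y₂ : ℝ, y₁ ≠ y₂ ∧ A * y₁ ^ 4 - K * y₁ + C = 0 ∧ A * y₂ ^ 4 - K * y₂ + C = 0 ∧
      0 < y₁ ∧ y₁ < c ∧ c < y₂ ∧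
      ∀ y : ℝ, A * y ^ 4 - K * y + C = 0 → y = y₁ ∨ y = y₂ := by
  have hcont : Continuous fun y : ℝ => A * y ^ 4 - K * y + C := by fun_prop
  obtain ⟨y₁, ⟨hy₁, hy₁c⟩, h₁⟩ := intermediate_value_Ioo' hc.le hcont.continuousOn
    (show (0 : ℝ) ∈ Set.Ioo _ _ from ⟨hneg, by simpa using hC⟩)
  set R := 1 + c + K / A with hR
  have hKA : 0 ≤ K / A := by positivity
  have hR₁ : 1 ≤ R := by linarith
  have hKR : K ≤ A * R := by
    have : A * (K / A) = K := mul_div_cancel₀ K hA.ne'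
    nlinarith
  have hpos : 0 < A * R ^ 4 - K * R + C := by
    have hpow : R ^ 2 ≤ R ^ 4 := pow_le_pow_right₀ hR₁ (by norm_num)
    nlinarith [mul_le_mul_of_nonneg_left hpow hA.le,
      mul_le_mul_of_nonneg_right hKR (zero_le_one.trans hR₁)]
  obtain ⟨y₂, ⟨hcy₂, -⟩, h₂⟩ := intermediate_value_Ioo (show c ≤ R by linarith)
    hcont.continuousOn (show (0 : ℝ) ∈ Set.Ioo _ _ from ⟨hneg, hpos⟩)
  have hne : y₁ ≠ y₂ := (hy₁c.trans hcy₂).ne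
  exact ⟨y₁, y₂, hne, h₁, h₂, hy₁, hy₁c, hcy₂,
    fun y hy => quartic_root_eq_or_eq hA.ne' hne h₁ h₂ hy⟩


/-- **Real roots of the Fermat–Torricelli quartic.**
For `a > 0` and `B₁ > B₄ > 0`, the quartic
`p y = 64 y⁴ (B₁² - B₄²) - 8√2 a³ y (B₁² + B₄²) + 3 a⁴ (B₁² - B₄²)` has exactly two real
roots: one in the open interval `(0, a√2/4)` and one greater than `a√2/4`. -/
theorem quartic_two_real_roots
    (a B₁ B₄ : ℝ) (ha : 0 < a) (hB₄ : 0 < B₄) (hB : B₄ < B₁)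
    (p : ℝ → ℝ)
    (hp : ∀ y, p y = 64 * y ^ 4 * (B₁ ^ 2 - B₄ ^ 2) -
      8 * Real.sqrt 2 * a ^ 3 * y * (B₁ ^ 2 + B₄ ^ 2) + 3 * a ^ 4 * (B₁ ^ 2 - B₄ ^ 2)) :
    ∃ y₁ y₂ : ℝ, y₁ ≠ y₂ ∧ p y₁ = 0 ∧ p y₂ = 0 ∧
      0 < y₁ ∧ y₁ < a * Real.sqrt 2 / 4 ∧ a * Real.sqrt 2 / 4 < y₂ ∧
      ∀ y : ℝ, p y = 0 → y = y₁ ∨ y = y₂ := by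
  have hD : 0 < B₁ ^ 2 - B₄ ^ 2 := by nlinarith
  have hs : Real.sqrt 2 ^ 2 = 2 := Real.sq_sqrt (by norm_num)
  have hp' : ∀ y, p y = 64 * (B₁ ^ 2 - B₄ ^ 2) * y ^ 4 -
      8 * Real.sqrt 2 * a ^ 3 * (B₁ ^ 2 + B₄ ^ 2) * y + 3 * a ^ 4 * (B₁ ^ 2 - B₄ ^ 2) :=
    fun y => by rw [hp]; ring
  simp only [hp']
  refine quartic_exists_two_roots (by positivity) (by positivity) (by positivity)
    (by positivity) ?_
  have hval : 64 * (B₁ ^ 2 - B₄ ^ 2) * (a * Real.sqrt 2 / 4) ^ 4 -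
      8 * Real.sqrt 2 * a ^ 3 * (B₁ ^ 2 + B₄ ^ 2) * (a * Real.sqrt 2 / 4) +
      3 * a ^ 4 * (B₁ ^ 2 - B₄ ^ 2) = -(8 * a ^ 4 * B₄ ^ 2) := by
    linear_combination (a ^ 4 * (B₁ ^ 2 - B₄ ^ 2) / 4 * (Real.sqrt 2 ^ 2 + 2) -
      2 * a ^ 4 * (B₁ ^ 2 + B₄ ^ 2)) * hs
  rw [hval]
  exact neg_neg_of_pos (by positivity)
end

section
/- Let a > 0 and B₁ > B₄ > 0. With s and t defined as in the analytical solution (s = −a⁶(B₁¹² − 2B₁¹⁰B₄² − B₁⁸B₄⁴ + 4B₁⁶B₄⁶ − B₁⁴B₄⁸ − 2B₁²B₄¹⁰ + B₄¹²) + 2√2·√(a¹²B₁²B₄²(B₁²−B₄²)⁴(B₁⁴ − 4B₁²B₄² + B₄⁴)²·…) as the explicit degree-24 polynomial expression, and t = −a⁴B₁⁴/(4 s^{1/3}) + a⁴B₁²B₄²/(2 s^{1/3}) − a⁴B₄⁴/(4 s^{1/3}) − s^{1/3}/(4(B₁⁴ − 2B₁²B₄² + B₄⁴))), the number y₁ =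 √t/2 + (1/2)·√( a⁴B₁⁴/(4 s^{1/3}) − a⁴B₁²B₄²/(2 s^{1/3}) + a⁴B₄⁴/(4 s^{1/3}) − 2(−8√2 a³B₁² − 8√2 a³B₄²)/(√t·(64B₁² − 64B₄²)) + s^{1/3}/(4(B₁⁴ − 2B₁²B₄² + B₄⁴)) ) satisfies the quartic equation 64 y₁⁴ (B₁² − B₄²) − 8√2 a³ y₁ (B₁² + B₄²) + 3 a⁴ (B₁² − B₄²) = 0 and satisfies y₁ > a√2/4, so the corresponding point (0,0,y₁) (the complementary weighted Fermat-Torricelli point for weights B₁ = B₂ > 0, B₃ = B₄ < 0, or B₁ = B₂ < 0, B₃ = B₄ > 0, with |B₁| > |B₄|) lies outside the regular tetrahedron. -/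
/-- The largest real root of the depressed quartic `y ^ 4 - q * y + r`, expressed through the
square root `R` of a positive root of its cubic resolvent. -/
lemma quartic_ferrari_root {R q r y : ℝ} (hR : 0 < R) (hq : 0 < q)
    (hres : R ^ 6 = 4 * r * R ^ 2 + q ^ 2) (hle : R ^ 6 ≤ 4 * q ^ 2)
    (hy : y = R / 2 + 1 / 2 * √(2 * (q / R) - R ^ 2)) :
    y ^ 4 - q * y + r = 0 ∧ ∀ h : ℝ, h ^ 4 - q * h + r < 0 → h < y := by
  obtain ⟨k, hk⟩ : ∃ k, k = q / R := ⟨_, rfl⟩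
  rw [← hk] at hy
  have hkR : q = k * R := by rw [hk]; field_simp
  have hk0 : 0 < k := hk ▸ div_pos hq hR
  have hr : 4 * r = R ^ 4 - k ^ 2 := by
    have h2 : R ^ 2 ≠ 0 := by positivity
    apply mul_right_cancel₀ h2
    rw [hkR] at hres
    linear_combination -hres
  have hX : 0 ≤ 2 * k - R ^ 2 := by
    have h3 : R ^ 3 ≤ 2 * q := by
      apply le_of_sq_le_sq _ (by positivity)
      nlinarith
    rw [hkR] at h3
    have : R * R ^ 2 ≤ R * (2 * k) := by nlinarith
    linarith [le_of_mul_le_mul_left this hR]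
  have hs := Real.sq_sqrt hX
  have hs0 := Real.sqrt_nonneg (2 * k - R ^ 2)
  set b := √(2 * k - R ^ 2)
  have factor (z : ℝ) : 16 * (z ^ 4 - q * z + r) =
      ((2 * z - R) ^ 2 - b ^ 2) * ((2 * z + R) ^ 2 + R ^ 2 + 2 * k) := by
    rw [hs, hkR]; linear_combination 4 * hr
  refine ⟨?_, fun h hh => ?_⟩
  · have := factor y
    have e : (2 * y - R) ^ 2 - b ^ 2 = 0 := by rw [hy]; ring
    rw [e] at this
    linarith
  · have hf := factor h
    have hpos : 0 < (2 * h + R) ^ 2 + R ^ 2 + 2 * k := by positivity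
    have hneg : (2 * h - R) ^ 2 - b ^ 2 < 0 := by
      by_contra! hcon
      nlinarith [mul_nonneg hcon hpos.le]
    have := abs_lt_of_sq_lt_sq (by linarith : (2 * h - R) ^ 2 < b ^ 2) hs0
    linarith [(abs_lt.mp this).2]

/-- Cardano's formula for `u ^ 3 = 3 * m * u + n`, with the size bound `u ^ 3 ≤ 4 * n` that holds
when both cube roots are positive. -/
lemma cardano_root {v w m n : ℝ} (hv : 0 < v) (hw : 0 < w) (hm : v * w = m)
    (hn : v ^ 3 + w ^ 3 = n) :
    (v + w) ^ 3 = 3 * m * (v + w) + n ∧ (v + w) ^ 3 ≤ 4 * n := by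
  subst hm hn
  exact ⟨by ring, by nlinarith [mul_nonneg (add_pos hv hw).le (sq_nonneg (v - w))]⟩

/-- **The complementary weighted Fermat–Torricelli point of the regular tetrahedron.**
With `s` the auxiliary radical expression, `c = s^{1/3}` its real cube root (`c ^ 3 = s`) and
`t` as in the analytical solution, the second real root
`y₁ = √t/2 + (1/2)√(a⁴B₁⁴/(4c) - a⁴B₁²B₄²/(2c) + a⁴B₄⁴/(4c)
  - 2(-8√2 a³B₁² - 8√2 a³B₄²)/(√t (64B₁² - 64B₄²)) + c/(4(B₁⁴ - 2B₁²B₄² + B₄⁴)))`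
satisfies the quartic `64 y₁⁴ (B₁² - B₄²) - 8√2 a³ y₁ (B₁² + B₄²) + 3 a⁴ (B₁² - B₄²) = 0` and
`y₁ > a√2/4`, so the complementary weighted Fermat–Torricelli point `(0,0,y₁)` lies outside
the regular tetrahedron. -/
theorem complementary_fermat_torricelli_point_regular_tetrahedron
    (a B₁ B₄ : ℝ) (ha : 0 < a) (hB₄ : 0 < B₄) (hB : B₄ < B₁)
    (s : ℝ)
    (hs : s = -(a ^ 6 * B₁ ^ 12) + 2 * a ^ 6 * B₁ ^ 10 * B₄ ^ 2 + a ^ 6 * B₁ ^ 8 * B₄ ^ 4 -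
        4 * a ^ 6 * B₁ ^ 6 * B₄ ^ 6 + a ^ 6 * B₁ ^ 4 * B₄ ^ 8 + 2 * a ^ 6 * B₁ ^ 2 * B₄ ^ 10 -
        a ^ 6 * B₄ ^ 12 +
        2 * Real.sqrt 2 * Real.sqrt (a ^ 12 * B₁ ^ 22 * B₄ ^ 2 - 8 * a ^ 12 * B₁ ^ 20 * B₄ ^ 4 +
          29 * a ^ 12 * B₁ ^ 18 * B₄ ^ 6 - 64 * a ^ 12 * B₁ ^ 16 * B₄ ^ 8 +
          98 * a ^ 12 * B₁ ^ 14 * B₄ ^ 10 - 112 * a ^ 12 * B₁ ^ 12 * B₄ ^ 12 +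
          98 * a ^ 12 * B₁ ^ 10 * B₄ ^ 14 - 64 * a ^ 12 * B₁ ^ 8 * B₄ ^ 16 +
          29 * a ^ 12 * B₁ ^ 6 * B₄ ^ 18 - 8 * a ^ 12 * B₁ ^ 4 * B₄ ^ 20 +
          a ^ 12 * B₁ ^ 2 * B₄ ^ 22))
    (c : ℝ) (hc : c ^ 3 = s)  -- `c` is the real cube root `s^{1/3}` of `s`
    (t : ℝ)
    (ht : t = -(a ^ 4 * B₁ ^ 4 / (4 * c)) + a ^ 4 * B₁ ^ 2 * B₄ ^ 2 / (2 * c) -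
        a ^ 4 * B₄ ^ 4 / (4 * c) - c / (4 * (B₁ ^ 4 - 2 * B₁ ^ 2 * B₄ ^ 2 + B₄ ^ 4)))
    (y₁ : ℝ)
    (hy₁ : y₁ = Real.sqrt t / 2 +
        (1 / 2) * Real.sqrt (a ^ 4 * B₁ ^ 4 / (4 * c) - a ^ 4 * B₁ ^ 2 * B₄ ^ 2 / (2 * c) +
          a ^ 4 * B₄ ^ 4 / (4 * c) -
          2 * (-(8 * Real.sqrt 2 * a ^ 3 * B₁ ^ 2) - 8 * Real.sqrt 2 * a ^ 3 * B₄ ^ 2) /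
            (Real.sqrt t * (64 * B₁ ^ 2 - 64 * B₄ ^ 2)) +
          c / (4 * (B₁ ^ 4 - 2 * B₁ ^ 2 * B₄ ^ 2 + B₄ ^ 4)))) :
    64 * y₁ ^ 4 * (B₁ ^ 2 - B₄ ^ 2) - 8 * Real.sqrt 2 * a ^ 3 * y₁ * (B₁ ^ 2 + B₄ ^ 2) +
        3 * a ^ 4 * (B₁ ^ 2 - B₄ ^ 2) = 0 ∧
      a * Real.sqrt 2 / 4 < y₁ := by
  have hD : 0 < B₁ ^ 2 - B₄ ^ 2 := by nlinarith
  have hS : 0 < B₁ ^ 2 + B₄ ^ 2 := by positivity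
  have h2 : √2 ^ 2 = 2 := Real.sq_sqrt (by norm_num)
  obtain ⟨D, hDe⟩ : ∃ D, D = B₁ ^ 2 - B₄ ^ 2 := ⟨_, rfl⟩
  obtain ⟨S, hSe⟩ : ∃ S, S = B₁ ^ 2 + B₄ ^ 2 := ⟨_, rfl⟩
  rw [← hDe] at hD
  rw [← hSe] at hS
  have hSD : D < S := by rw [hDe, hSe]; nlinarith [pow_pos hB₄ 2]
  obtain ⟨Q, hQe, hQ0⟩ : ∃ Q, s = -(a ^ 6 * S ^ 2 * D ^ 4) + 2 * √2 * Q ∧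
      8 * Q ^ 2 = a ^ 12 * D ^ 8 * (S ^ 4 - D ^ 4) := by
    refine ⟨_, hs.trans (congrArg (· + _) ?_), ?_⟩
    · rw [hSe, hDe]; ring
    · rw [Real.sq_sqrt]
      · rw [hSe, hDe]; ring
      · have : 0 ≤ a ^ 12 * (B₁ ^ 2 - B₄ ^ 2) ^ 8 * (B₁ ^ 2 * B₄ ^ 2 * (B₁ ^ 4 + B₄ ^ 4)) := by
          positivity
        convert this using 1
        ring
  have hquad : s ^ 2 + 2 * a ^ 6 * S ^ 2 * D ^ 4 * s + a ^ 12 * D ^ 12 = 0 := by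
    rw [hQe]; linear_combination 4 * Q ^ 2 * h2 + hQ0
  have hsneg : s < 0 := by
    by_contra! h
    have : 0 < s ^ 2 + 2 * a ^ 6 * S ^ 2 * D ^ 4 * s + a ^ 12 * D ^ 12 := by positivity
    linarith
  have hcneg : c < 0 := by
    by_contra! h
    have : 0 ≤ c ^ 3 := by positivity
    linarith
  obtain ⟨v, hve⟩ : ∃ v, v = -(a ^ 4 * D ^ 2 / (4 * c)) := ⟨_, rfl⟩
  obtain ⟨w, hwe⟩ : ∃ w, w = -(c / (4 * D ^ 2)) := ⟨_, rfl⟩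
  obtain ⟨q, hqe⟩ : ∃ q, q = √2 * a ^ 3 * S / (8 * D) := ⟨_, rfl⟩
  have hv : 0 < v := by
    rw [hve, neg_pos]
    exact div_neg_of_pos_of_neg (by positivity) (by linarith)
  have hw : 0 < w := by
    rw [hwe, neg_pos]
    exact div_neg_of_neg_of_pos hcneg (by positivity)
  have hq : 0 < q := by rw [hqe]; positivity
  have hc0 : c ≠ 0 := hcneg.ne
  have hm : v * w = a ^ 4 / 16 := by
    rw [hve, hwe]; field_simp; norm_num
  have hn : v ^ 3 + w ^ 3 = q ^ 2 := by
    have hq2 : q ^ 2 = a ^ 6 * S ^ 2 / (32 * D ^ 2) := by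
      rw [hqe, div_pow, mul_pow, mul_pow, h2]; field_simp; norm_num
    rw [← hc] at hquad
    rw [hq2, hve, hwe]
    field_simp
    linear_combination -32 * hquad
  obtain ⟨hcub, hle⟩ := cardano_root hv hw hm hn
  have htvw : t = v + w := by
    have : B₁ ^ 4 - 2 * B₁ ^ 2 * B₄ ^ 2 + B₄ ^ 4 = D ^ 2 := by rw [hDe]; ring
    rw [ht, this, hve, hwe]
    linear_combination -(a ^ 4 / (4 * c)) * this
  have ht0 : 0 < t := htvw ▸ add_pos hv hw
  have hR : 0 < √t := Real.sqrt_pos.mpr ht0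
  have hRt : √t ^ 2 = t := Real.sq_sqrt ht0.le
  have hR6 : √t ^ 6 = t ^ 3 := by
    rw [show √t ^ 6 = (√t ^ 2) ^ 3 by ring, hRt]
  have hy : y₁ = √t / 2 + 1 / 2 * √(2 * (q / √t) - √t ^ 2) := by
    rw [hy₁]
    congr 3
    have e : 2 * (-(8 * √2 * a ^ 3 * B₁ ^ 2) - 8 * √2 * a ^ 3 * B₄ ^ 2) /
        (√t * (64 * B₁ ^ 2 - 64 * B₄ ^ 2)) = -(2 * (q / √t)) := by
      rw [show 64 * B₁ ^ 2 - 64 * B₄ ^ 2 = 64 * D by rw [hDe]; ring, hqe, hSe]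
      field_simp
      ring
    rw [e, hRt, ht]
    ring
  obtain ⟨hroot, hlarge⟩ := quartic_ferrari_root (r := 3 * a ^ 4 / 64) hR hq
    (by rw [hR6, hRt, htvw, hcub]; ring) (by rw [hR6, htvw]; exact hle) hy
  have hqD : 8 * D * q = √2 * a ^ 3 * S := by rw [hqe]; field_simp
  rw [← hDe, ← hSe]
  refine ⟨?_, hlarge _ ?_⟩
  · linear_combination 64 * D * hroot + 8 * y₁ * hqD
  · have h24 : √2 ^ 4 = 4 := by rw [show √2 ^ 4 = (√2 ^ 2) ^ 2 by ring, h2]; norm_num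
    have e : 16 * D * ((a * √2 / 4) ^ 4 - q * (a * √2 / 4) + 3 * a ^ 4 / 64) =
        a ^ 4 * (D - S) := by
      linear_combination (D * a ^ 4 / 16) * h24 - (a * √2 / 2) * hqD - (a ^ 4 * S / 2) * h2
    have : a ^ 4 * (D - S) < 0 := mul_neg_of_pos_of_neg (by positivity) (by linarith)
    by_contra! hcon
    have : 0 ≤ 16 * D * ((a * √2 / 4) ^ 4 - q * (a * √2 / 4) + 3 * a ^ 4 / 64) := by positivity
    linarith
end

section
/- Let A₁, A₂, A₃, A₄ be four affinely independent points in ℝ³ with positive weights B₁, B₂, B₃, B₄ satisfying the floating condition ‖Σ_{j≠i} Bⱼ(Aⱼ − Aᵢ)/‖Aⱼ − Aᵢ‖‖ > Bᵢ for every i, and let A₀ be the weighted Fermat-Torricelli point of A₁A₂A₃A₄. For each i, let Aᵢ′ = A₀ + tᵢ·(Aᵢ − A₀) with tᵢ > 0 be a point on the ray from A₀ through Aᵢ, carrying the same weight Bᵢ, and assume A₁′, A₂′, A₃′, A₄′ are affinely independent and also satisfy the floating condition ‖Σ_{j≠i} Bⱼ(Aⱼ′ − Aᵢ′)/‖Aⱼ′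 − Aᵢ′‖‖ > Bᵢ for every i. Then the weighted Fermat-Torricelli point of A₁′A₂′A₃′A₄′ is identical with A₀ (geometric plasticity / invariance of the weighted Fermat-Torricelli point). -/
open scoped RealInnerProductSpace

section WeightedDistanceSum

variable {ι E : Type*} [NormedAddCommGroup E] [InnerProductSpace ℝ E]

/-- Quadratic upper bound for the norm along a line. -/
lemma norm_add_smul_le_quadratic (w v : E) (hw : w ≠ 0) (s : ℝ) :
    ‖w + s • v‖ ≤ ‖w‖ + s * (⟪w, v⟫ / ‖w‖) + s ^ 2 * (‖v‖ ^ 2 / (2 * ‖w‖)) := by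
  have hpos : 0 < ‖w‖ := norm_pos_iff.mpr hw
  have hsq : ‖w + s • v‖ ^ 2 = ‖w‖ ^ 2 + 2 * (s * ⟪w, v⟫) + s ^ 2 * ‖v‖ ^ 2 := by
    rw [norm_add_sq_real, inner_smul_right, norm_smul, mul_pow, Real.norm_eq_abs, sq_abs]
  have hrhs : ‖w‖ + s * (⟪w, v⟫ / ‖w‖) + s ^ 2 * (‖v‖ ^ 2 / (2 * ‖w‖))
      = (‖w + s • v‖ ^ 2 + ‖w‖ ^ 2) / (2 * ‖w‖) := by
    rw [hsq]
    field_simp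
    ring
  rw [hrhs, le_div_iff₀ (by positivity)]
  linarith [two_mul_le_add_sq ‖w + s • v‖ ‖w‖]

/-- First-order condition at a minimizer of a weighted sum of distances, where the minimizer
itself may carry weight `c`. -/
lemma norm_weighted_sum_unit_le_of_isMin (s : Finset ι) (A : ι → E) (B : ι → ℝ) (c : ℝ)
    (x : E) (hB : ∀ j ∈ s, 0 ≤ B j) (hx : ∀ j ∈ s, A j ≠ x)
    (hmin : ∀ y, ∑ j ∈ s, B j * ‖x - A j‖ ≤ c * ‖y - x‖ + ∑ j ∈ s, B j * ‖y - A j‖)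
    (hc : 0 ≤ c) :
    ‖∑ j ∈ s, (B j / ‖A j - x‖) • (A j - x)‖ ≤ c := by
  set V := ∑ j ∈ s, (B j / ‖A j - x‖) • (A j - x) with hV
  set K := ∑ j ∈ s, B j * (‖V‖ ^ 2 / (2 * ‖x - A j‖)) with hK
  have hK0 : 0 ≤ K := Finset.sum_nonneg fun j hj => mul_nonneg (hB j hj) (by positivity)
  have hVV : ∑ j ∈ s, B j * (⟪x - A j, V⟫ / ‖x - A j‖) = -‖V‖ ^ 2 := by
    rw [← real_inner_self_eq_norm_sq]
    conv_rhs => rw [hV, sum_inner, ← hV, ← Finset.sum_neg_distrib]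
    refine Finset.sum_congr rfl fun j _ => ?_
    rw [real_inner_smul_left, ← neg_sub x (A j), inner_neg_left, norm_neg]
    ring
  have hquad : ∀ r : ℝ, 0 < r → ‖V‖ ^ 2 - c * ‖V‖ ≤ r * K := by
    intro r hr
    have hsum : ∑ j ∈ s, B j * ‖x + r • V - A j‖
        ≤ ∑ j ∈ s, B j * ‖x - A j‖ + r * -‖V‖ ^ 2 + r ^ 2 * K := by
      rw [← hVV, hK, Finset.mul_sum, Finset.mul_sum, ← Finset.sum_add_distrib,
        ← Finset.sum_add_distrib]
      refine Finset.sum_le_sum fun j hj => ?_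
      have := mul_le_mul_of_nonneg_left (norm_add_smul_le_quadratic (x - A j) V
        (sub_ne_zero.mpr (hx j hj).symm) r) (hB j hj)
      rw [add_sub_right_comm]
      linarith
    have hy := hmin (x + r • V)
    rw [add_sub_cancel_left, norm_smul, Real.norm_of_nonneg hr.le] at hy
    have : r * (‖V‖ ^ 2 - c * ‖V‖) ≤ r * (r * K) := by linarith
    exact le_of_mul_le_mul_left this hr
  have hle : ‖V‖ ^ 2 - c * ‖V‖ ≤ 0 := by
    refine le_of_forall_pos_le_add fun ε hε => ?_
    refine (hquad (ε / (K + 1)) (by positivity)).trans ?_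
    rw [zero_add, div_mul_eq_mul_div, div_le_iff₀ (by positivity)]
    nlinarith
  by_contra! hlt
  nlinarith [norm_nonneg V]

variable [Fintype ι] {A : ι → E} {B : ι → ℝ} {x : E}

/-- Under the floating condition, a minimizer of the weighted distance sum is not a vertex. -/
lemma ne_of_isMin_of_floating [DecidableEq ι] (hA : Function.Injective A) (hB : ∀ i, 0 < B i)
    (hfloat : ∀ i, B i < ‖∑ j ∈ Finset.univ.erase i, (B j / ‖A j - A i‖) • (A j - A i)‖)
    (hmin : ∀ y, ∑ i, B i * ‖x - A i‖ ≤ ∑ i, B i * ‖y - A i‖) (i : ι) : A i ≠ x := by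
  rintro rfl
  refine (hfloat i).not_ge <| norm_weighted_sum_unit_le_of_isMin _ A B (B i) (A i)
    (fun j _ => (hB j).le) (fun j hj => hA.ne (Finset.ne_of_mem_erase hj)) (fun y => ?_) (hB i).le
  have h := hmin y
  rw [← Finset.add_sum_erase _ _ (Finset.mem_univ i),
    ← Finset.add_sum_erase _ _ (Finset.mem_univ i)] at h
  simpa using h

/-- Equilibrium condition at a minimizer of the weighted distance sum that is not a vertex. -/
lemma weighted_sum_unit_eq_zero_of_isMin (hB : ∀ i, 0 < B i) (hx : ∀ i, A i ≠ x)
    (hmin : ∀ y, ∑ i, B i * ‖x - A i‖ ≤ ∑ i, B i * ‖y - A i‖) :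
    ∑ i, (B i / ‖A i - x‖) • (A i - x) = 0 :=
  norm_le_zero_iff.mp <| norm_weighted_sum_unit_le_of_isMin _ A B 0 x (fun j _ => (hB j).le)
    (fun j _ => hx j) (fun y => by simpa using hmin y) le_rfl

/-- Moving along rays from `x` preserves the equilibrium condition at `x`. -/
lemma weighted_sum_unit_eq_zero_of_rays {A' : ι → E} {t : ι → ℝ} (ht : ∀ i, 0 < t i)
    (hA' : ∀ i, A' i = x + t i • (A i - x))
    (h : ∑ i, (B i / ‖A i - x‖) • (A i - x) = 0) :
    ∑ i, (B i / ‖A' i - x‖) • (A' i - x) = 0 := by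
  rw [← h]
  refine Finset.sum_congr rfl fun i _ => ?_
  have hti := (ht i).ne'
  rw [hA' i, add_sub_cancel_left, norm_smul, Real.norm_of_nonneg (ht i).le, smul_smul]
  congr 1
  rw [div_mul_eq_mul_div, mul_comm (B i), mul_div_mul_left _ _ hti]

/-- Equilibrium makes the weighted sum of the directional components of `A i - y` independent
of `y`. -/
lemma sum_inner_div_norm_eq_of_equilibrium
    (h : ∑ i, (B i / ‖A i - x‖) • (A i - x) = 0) (y : E) :
    ∑ i, B i * (⟪A i - y, A i - x⟫ / ‖A i - x‖) = ∑ i, B i * ‖x - A i‖ := by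
  have h0 : ∑ i, B i * (⟪x - y, A i - x⟫ / ‖A i - x‖) = 0 := by
    have := congrArg (fun v => ⟪x - y, v⟫) h
    simp only [inner_sum, inner_smul_right, inner_zero_right] at this
    rw [← this]
    exact Finset.sum_congr rfl fun i _ => by ring
  rw [← sub_zero (∑ i, B i * (⟪A i - y, A i - x⟫ / ‖A i - x‖)), ← h0,
    ← Finset.sum_sub_distrib]
  refine Finset.sum_congr rfl fun i _ => ?_
  rw [← mul_sub, ← sub_div, ← inner_sub_left, sub_sub_sub_cancel_right,
    real_inner_self_eq_norm_sq, norm_sub_rev x, sq, mul_self_div_self]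

lemma inner_div_norm_le_norm_sub (a x y : E) : ⟪a - y, a - x⟫ / ‖a - x‖ ≤ ‖y - a‖ := by
  rw [norm_sub_rev y]
  exact div_le_of_le_mul₀ (norm_nonneg _) (norm_nonneg _) (real_inner_le_norm _ _)

/-- Equilibrium at `x` makes `x` a minimizer of the weighted distance sum. -/
lemma isMin_of_equilibrium (hB : ∀ i, 0 < B i)
    (h : ∑ i, (B i / ‖A i - x‖) • (A i - x) = 0) (y : E) :
    ∑ i, B i * ‖x - A i‖ ≤ ∑ i, B i * ‖y - A i‖ := by
  rw [← sum_inner_div_norm_eq_of_equilibrium h y]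
  exact Finset.sum_le_sum fun i _ =>
    mul_le_mul_of_nonneg_left (inner_div_norm_le_norm_sub _ _ _) (hB i).le

/-- If equilibrium holds at `x`, a second minimizer forces the points to be collinear. -/
lemma collinear_of_equilibrium_of_isMin (hB : ∀ i, 0 < B i) (hx : ∀ i, A i ≠ x)
    (h : ∑ i, (B i / ‖A i - x‖) • (A i - x) = 0) {y : E} (hyx : y ≠ x)
    (hy : ∑ i, B i * ‖y - A i‖ ≤ ∑ i, B i * ‖x - A i‖) :
    Collinear ℝ (Set.range A) := by
  rw [← sum_inner_div_norm_eq_of_equilibrium h y] at hy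
  have hterm : ∀ i ∈ Finset.univ, B i * (⟪A i - y, A i - x⟫ / ‖A i - x‖) ≤ B i * ‖y - A i‖ :=
    fun i _ => mul_le_mul_of_nonneg_left (inner_div_norm_le_norm_sub _ _ _) (hB i).le
  have heq := (Finset.sum_eq_sum_iff_of_le hterm).mp ((Finset.sum_le_sum hterm).antisymm hy)
  refine (collinear_iff_exists_forall_eq_smul_vadd _).mpr ⟨x, y - x, ?_⟩
  rintro _ ⟨i, rfl⟩
  have hq : ‖A i - x‖ ≠ 0 := norm_ne_zero_iff.mpr (sub_ne_zero.mpr (hx i))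
  have hinner := mul_left_cancel₀ (hB i).ne' (heq i (Finset.mem_univ i))
  rw [div_eq_iff hq, norm_sub_rev, inner_eq_norm_mul_iff_real] at hinner
  have hline : (‖A i - x‖ - ‖A i - y‖) • (A i - x) = ‖A i - x‖ • (y - x) := by
    rw [sub_smul, ← hinner, ← smul_sub, sub_sub_sub_cancel_left]
  have hd : ‖A i - x‖ - ‖A i - y‖ ≠ 0 := by
    intro hd
    rw [hd, zero_smul] at hline
    exact smul_ne_zero hq (sub_ne_zero.mpr hyx) hline.symm
  refine ⟨‖A i - x‖ / (‖A i - x‖ - ‖A i - y‖), ?_⟩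
  rw [vadd_eq_add, ← sub_eq_iff_eq_add, div_eq_inv_mul, mul_smul, ← hline, inv_smul_smul₀ hd]

end WeightedDistanceSum


/-- **Geometric plasticity (invariance) of the weighted Fermat–Torricelli point.**
Let `A₀` be the weighted Fermat–Torricelli point of four affinely independent points
`A 0, …, A 3` with positive weights satisfying the floating condition at each vertex.
If each `A i` is replaced by a point `A' i = A₀ + t i • (A i - A₀)` (with `t i > 0`) on the
ray from `A₀` through `A i`, carrying the same weight, and the new points are affinely
independent and again satisfy the floating condition, then the weighted Fermat–Torricelli
point of the new tetrahedron is identical with `A₀`. -/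
theorem geometric_plasticity_weighted_fermat_torricelli
    (A : Fin 4 → EuclideanSpace ℝ (Fin 3)) (hA : AffineIndependent ℝ A)
    (B : Fin 4 → ℝ) (hB : ∀ i, 0 < B i)
    (hfloat : ∀ i : Fin 4,
      B i < ‖∑ j ∈ Finset.univ.erase i, (B j / ‖A j - A i‖) • (A j - A i)‖)
    (A₀ : EuclideanSpace ℝ (Fin 3))
    (hmin : ∀ Y : EuclideanSpace ℝ (Fin 3), ∑ i, B i * ‖A₀ - A i‖ ≤ ∑ i, B i * ‖Y - A i‖)
    (t : Fin 4 → ℝ) (ht : ∀ i, 0 < t i)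
    (A' : Fin 4 → EuclideanSpace ℝ (Fin 3)) (hA' : ∀ i, A' i = A₀ + t i • (A i - A₀))
    (hA'indep : AffineIndependent ℝ A')
    (hfloat' : ∀ i : Fin 4,
      B i < ‖∑ j ∈ Finset.univ.erase i, (B j / ‖A' j - A' i‖) • (A' j - A' i)‖) :
    (∀ Y : EuclideanSpace ℝ (Fin 3), ∑ i, B i * ‖A₀ - A' i‖ ≤ ∑ i, B i * ‖Y - A' i‖) ∧
      ∀ X : EuclideanSpace ℝ (Fin 3),
        (∀ Y, ∑ i, B i * ‖X - A' i‖ ≤ ∑ i, B i * ‖Y - A' i‖) → X = A₀ := by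
  have hne := ne_of_isMin_of_floating hA.injective hB hfloat hmin
  have heq := weighted_sum_unit_eq_zero_of_rays ht hA'
    (weighted_sum_unit_eq_zero_of_isMin hB hne hmin)
  have hne' : ∀ i, A' i ≠ A₀ := fun i => by
    rw [hA' i, Ne, add_eq_left]
    exact smul_ne_zero (ht i).ne' (sub_ne_zero.mpr (hne i))
  refine ⟨isMin_of_equilibrium hB heq, fun X hX => ?_⟩
  by_contra hXne
  have hcol := collinear_of_equilibrium_of_isMin hB hne' heq hXne (hX A₀)
  have hrank := hA'indep.finrank_vectorSpan (n := 3) (by simp)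
  have := collinear_iff_finrank_le_one.mp hcol
  omega
end

section
/- Let a > 0, B₁ > B₄ > 0, and let A₀ = (0,0,y₀) be the weighted Fermat-Torricelli point of the regular tetrahedron A₁A₂A₃A₄ (vertices A₁ = (a/2, 0, a√2/4), A₂ = (−a/2, 0, a√2/4), A₃ = (0, a/2, −a√2/4), A₄ = (0, −a/2, −a√2/4)) with weights B₁ = B₂ and B₃ = B₄ in the floating case. Let A₄′ = A₀ + t·(A₄ − A₀) with t > 0 be any point on the ray from A₀ through A₄ such that the tetrahedron A₁A₂A₃A₄′ (with base the equilateral triangle A₁A₂A₃ of side a and the same weights B₁ = B₂ at A₁, A₂ and B₃ = B₄ at A₃, A₄′) satisfies the floating condition ‖Σ_{j≠i} Bⱼ(Aⱼ′ − Aᵢ′)/‖Aⱼ′ − Aᵢ′‖‖ > Bᵢ for all i (where Aᵢ′ = Aᵢ for i = 1,2,3). Then the weighted Fermat-Torricelli point of A₁A₂A₃A₄′ is identical with A₀, and consequently the distance ‖A₀ − A₄′‖ equals ‖A₀ − A₄‖ + (t − 1)·‖A₀ − A₄‖ = t·‖A₀ − A₄‖. -/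
theorem hasFDerivAt_norm_sub {E : Type*} [NormedAddCommGroup E] [InnerProductSpace ℝ E]
    {x a : E} (h : x ≠ a) :
    HasFDerivAt (fun y => ‖y - a‖) (‖x - a‖⁻¹ • innerSL ℝ (x - a)) x := by
  have hn : ‖x - a‖ ≠ 0 := norm_ne_zero_iff.mpr (sub_ne_zero.mpr h)
  have h1 := (((hasFDerivAt_id x).sub_const a).norm_sq).sqrt (pow_ne_zero 2 hn)
  simp only [id, Real.sqrt_sq (norm_nonneg _)] at h1
  refine h1.congr_fderiv ?_
  ext v
  simp
  field_simp

/-- First-order condition: at a minimizer of a weighted sum of distances which is not one of the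
vertices, the weighted unit vectors towards the vertices sum to zero. -/
theorem sum_weighted_unit_eq_zero_of_isMin {E ι : Type*} [NormedAddCommGroup E]
    [InnerProductSpace ℝ E] [Fintype ι] {B : ι → ℝ} {A : ι → E} {x : E}
    (hx : ∀ i, x ≠ A i)
    (hmin : ∀ y, ∑ i, B i * ‖x - A i‖ ≤ ∑ i, B i * ‖y - A i‖) :
    ∑ i, (B i / ‖A i - x‖) • (A i - x) = 0 := by
  have hd : HasFDerivAt (fun y => ∑ i, B i * ‖y - A i‖)
      (∑ i, B i • (‖x - A i‖⁻¹ • innerSL ℝ (x - A i))) x :=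
    HasFDerivAt.fun_sum fun i _ => (hasFDerivAt_norm_sub (hx i)).const_mul (B i)
  have h0 := IsLocalMin.hasFDerivAt_eq_zero (Filter.Eventually.of_forall hmin) hd
  refine ext_inner_right ℝ fun v => ?_
  have h1 := congrArg (fun L : E →L[ℝ] ℝ => -L v) h0
  simp only [sum_apply, smul_apply, innerSL_apply_apply, smul_eq_mul, zero_apply, neg_zero,
    ← Finset.sum_neg_distrib] at h1
  rw [sum_inner, inner_zero_left, ← h1]
  refine Finset.sum_congr rfl fun i _ => ?_
  rw [real_inner_smul_left, norm_sub_rev, ← neg_sub x (A i), inner_neg_left]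
  ring

/-- If unit vectors `u i` pointing from `x` to the vertices `A i` are balanced by positive
weights, the weighted sum of distances is minimal at `x`, and any other minimizer `y` differs
from `x` by a multiple of each `u i`. -/
theorem isMin_and_smul_of_balanced {E ι : Type*} [NormedAddCommGroup E]
    [InnerProductSpace ℝ E] [Fintype ι] {B : ι → ℝ} (hB : ∀ i, 0 < B i) {A u : ι → E} {x : E}
    (hu : ∀ i, ‖u i‖ = 1) (hA : ∀ i, A i - x = ‖A i - x‖ • u i)
    (hbal : ∑ i, B i • u i = 0) :
    (∀ y, ∑ i, B i * ‖x - A i‖ ≤ ∑ i, B i * ‖y - A i‖) ∧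
      ∀ y, (∀ z, ∑ i, B i * ‖y - A i‖ ≤ ∑ i, B i * ‖z - A i‖) →
        ∀ i, ∃ c : ℝ, y - x = c • u i := by
  have hsum (y : E) : ∑ i, B i * inner ℝ (A i - y) (u i) = ∑ i, B i * ‖x - A i‖ := by
    have h1 : ∑ i, B i * inner ℝ (x - y) (u i) = 0 := by
      have := congrArg (fun w => inner ℝ (x - y) w) hbal
      simpa [inner_sum, real_inner_smul_right] using this
    rw [← sub_zero (∑ i, B i * inner ℝ (A i - y) (u i)), ← h1, ← Finset.sum_sub_distrib]
    refine Finset.sum_congr rfl fun i _ => ?_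
    rw [← mul_sub, ← inner_sub_left, sub_sub_sub_cancel_right, hA i, real_inner_smul_left,
      real_inner_self_eq_norm_sq, hu, norm_sub_rev]
    ring
  have hle (y : E) (i : ι) : B i * inner ℝ (A i - y) (u i) ≤ B i * ‖y - A i‖ := by
    have := real_inner_le_norm (A i - y) (u i)
    rw [hu, mul_one, norm_sub_rev] at this
    exact mul_le_mul_of_nonneg_left this (hB i).le
  have hmin (y : E) : ∑ i, B i * ‖x - A i‖ ≤ ∑ i, B i * ‖y - A i‖ :=
    (hsum y).symm.le.trans (Finset.sum_le_sum fun i _ => hle y i)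
  refine ⟨hmin, fun y hy i => ?_⟩
  have heq := (Finset.sum_eq_sum_iff_of_le fun i _ => hle y i).mp
    ((hsum y).trans (le_antisymm (hmin y) (hy x))) i (Finset.mem_univ i)
  have h2 : inner ℝ (A i - y) (u i) = ‖A i - y‖ * ‖u i‖ := by
    rw [hu, mul_one, norm_sub_rev]
    exact mul_left_cancel₀ (hB i).ne' heq
  have h3 := inner_eq_norm_mul_iff_real.mp h2
  rw [hu, one_smul] at h3
  refine ⟨‖A i - x‖ - ‖A i - y‖, ?_⟩
  rw [sub_smul, ← h3, ← hA i]
  abel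

/-- **Plasticity applied to the regular tetrahedron with two pairs of equal weights.**
Let `A₀ = (0,0,y₀)` be the weighted Fermat–Torricelli point (floating case) of the regular
tetrahedron with vertices `A 0 = (a/2,0,a√2/4)`, `A 1 = (-a/2,0,a√2/4)`,
`A 2 = (0,a/2,-a√2/4)`, `A 3 = (0,-a/2,-a√2/4)` and weights `B₁ = B₂`, `B₃ = B₄`.  If
`A₄' = A₀ + t • (A 3 - A₀)` with `t > 0` is a point on the ray from `A₀` through `A 3` such
that the tetrahedron `A 0, A 1, A 2, A₄'` again satisfies the floating condition, then the
weighted Fermat–Torricelli point of the new tetrahedron is identical with `A₀`, and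
`‖A₀ - A₄'‖ = t * ‖A₀ - A 3‖`. -/
theorem plasticity_regular_tetrahedron_two_pairs
    (a B₁ B₄ y₀ t : ℝ) (ha : 0 < a) (hB₄ : 0 < B₄) (hB : B₄ < B₁) (htpos : 0 < t)
    (A : Fin 4 → EuclideanSpace ℝ (Fin 3))
    (hA0 : A 0 = pt (a / 2) 0 (a * Real.sqrt 2 / 4))
    (hA1 : A 1 = pt (-(a / 2)) 0 (a * Real.sqrt 2 / 4))
    (hA2 : A 2 = pt 0 (a / 2) (-(a * Real.sqrt 2 / 4)))
    (hA3 : A 3 = pt 0 (-(a / 2)) (-(a * Real.sqrt 2 / 4)))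
    (B : Fin 4 → ℝ) (hBdef : B = ![B₁, B₁, B₄, B₄])
    (A₀ : EuclideanSpace ℝ (Fin 3)) (hA₀ : A₀ = pt 0 0 y₀)
    (hmin : ∀ Y : EuclideanSpace ℝ (Fin 3), ∑ i, B i * ‖A₀ - A i‖ ≤ ∑ i, B i * ‖Y - A i‖)
    (hfloat : ∀ i : Fin 4,
      B i < ‖∑ j ∈ Finset.univ.erase i, (B j / ‖A j - A i‖) • (A j - A i)‖)
    (A' : Fin 4 → EuclideanSpace ℝ (Fin 3))
    (hA'fix : ∀ i : Fin 4, i ≠ 3 → A' i = A i)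
    (hA'4 : A' 3 = A₀ + t • (A 3 - A₀))
    (hfloat' : ∀ i : Fin 4,
      B i < ‖∑ j ∈ Finset.univ.erase i, (B j / ‖A' j - A' i‖) • (A' j - A' i)‖) :
    (∀ Y : EuclideanSpace ℝ (Fin 3), ∑ i, B i * ‖A₀ - A' i‖ ≤ ∑ i, B i * ‖Y - A' i‖) ∧
      (∀ X : EuclideanSpace ℝ (Fin 3),
        (∀ Y, ∑ i, B i * ‖X - A' i‖ ≤ ∑ i, B i * ‖Y - A' i‖) → X = A₀) ∧
      ‖A₀ - A' 3‖ = t * ‖A₀ - A 3‖ := by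
  have hne : ∀ i, A₀ ≠ A i := by
    intro i h
    have hx := congrArg (fun v : EuclideanSpace ℝ (Fin 3) => v 0) h
    have hy := congrArg (fun v : EuclideanSpace ℝ (Fin 3) => v 1) h
    fin_cases i <;> simp [hA₀, hA0, hA1, hA2, hA3, pt] at hx hy <;> linarith
  have hpos (i) : 0 < ‖A i - A₀‖ := norm_pos_iff.mpr (sub_ne_zero.mpr (hne i).symm)
  have hBpos : ∀ i, 0 < B i := by
    intro i
    fin_cases i <;> simp [hBdef] <;> linarith
  have hbal := sum_weighted_unit_eq_zero_of_isMin hne hmin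
  set u : Fin 4 → EuclideanSpace ℝ (Fin 3) := fun i => ‖A i - A₀‖⁻¹ • (A i - A₀) with hu
  have hscale : ∀ i, ∃ s : ℝ, 0 < s ∧ A' i - A₀ = s • (A i - A₀) := by
    intro i
    by_cases hi : i = 3
    · exact ⟨t, htpos, by rw [hi, hA'4, add_sub_cancel_left]⟩
    · exact ⟨1, one_pos, by rw [hA'fix i hi, one_smul]⟩
  obtain ⟨h1, h2⟩ := isMin_and_smul_of_balanced (A := A') (u := u) (x := A₀) hBpos
    (fun i => by simp [hu, norm_smul, (hpos i).ne'])
    (fun i => by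
      obtain ⟨s, hs, h⟩ := hscale i
      rw [h, norm_smul, Real.norm_of_nonneg hs.le, hu, smul_smul,
        mul_inv_cancel_right₀ (hpos i).ne'])
    (by simpa only [hu, smul_smul, div_eq_mul_inv] using hbal)
  refine ⟨h1, fun X hX => ?_, ?_⟩
  · obtain ⟨c, hc⟩ := h2 X hX 0
    obtain ⟨d, hd⟩ := h2 X hX 2
    have hcd := congrArg (fun v : EuclideanSpace ℝ (Fin 3) => v 0) (hc.symm.trans hd)
    have hc0 : c = 0 := by
      have hX0 : c * (‖A 0 - A₀‖⁻¹ * (a / 2)) = 0 := by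
        simpa [hu, show (A 0 - A₀) 0 = a / 2 by simp [hA₀, hA0, pt],
          show (A 2 - A₀) 0 = 0 by simp [hA₀, hA2, pt], -PiLp.sub_apply] using hcd
      have := hpos 0
      exact (mul_eq_zero.mp hX0).resolve_right (by positivity)
    rw [hc0, zero_smul] at hc
    exact sub_eq_zero.mp hc
  · rw [hA'4, sub_add_cancel_left, norm_neg, norm_smul, Real.norm_of_nonneg htpos.le, norm_sub_rev]
end
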